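/- Let s > 1/2 and set θ = min{2s-1, 1/2}. Then there exists C = C(s) such that for any M ≥ 1 and v₁, v₂, v₃ ∈ H^s(ℝ), the operator T^w_{|Φ|>M} defined on the Fourier side by F[T^w_{|Φ|>M}(v₁,v₂,v₃)](ξ) = ∫_{ξ=ξ₁-ξ₂+ξ₃, |Φ(ξ̄)|>M} (|ξ₂|/⟨Φ(ξ̄)⟩) v̂₁(ξ₁) conj(v̂₂(ξ₂)) v̂₃(ξ₃) dξ₁dξ₂ satisfies, for every choice of distinct indices {j,k,l} = {1,2,3}: ‖T^w_{|Φ|>M}(v₁,v₂,v₃)‖_{H^{s-1}(ℝ)} ≤ C M^{-θ} ‖v_j‖_{H^{s-1}} ‖v_k‖_{H^s} ‖v_l‖_{H^s}. -/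

import Mathlib

open MeasureTheory FourierTransform Complex

/-- The Japanese bracket `⟨x⟩ = (1+x²)^{1/2}`. -/
noncomputable def jb (x : ℝ) : ℝ := (1 + x ^ 2) ^ ((1 : ℝ) / 2)

/-- The Sobolev `H^s(ℝ)` norm, defined on the Fourier side. -/
noncomputable def sobolevNorm (s : ℝ) (f : ℝ → ℂ) : ℝ :=
  (∫ ξ : ℝ, jb ξ ^ (2 * s) * ‖𝓕 f ξ‖ ^ 2) ^ ((1 : ℝ) / 2)

/-- Membership in the Sobolev space `H^s(ℝ)`. -/
def memHs (s : ℝ) (f : ℝ → ℂ) : Prop :=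
  Integrable (fun ξ : ℝ => jb ξ ^ (2 * s) * ‖𝓕 f ξ‖ ^ 2)

/-- The modulation function `Φ(ξ̄) = ξ² - ξ₁² + ξ₂² - ξ₃²`. -/
def modPhi (ξ ξ₁ ξ₂ ξ₃ : ℝ) : ℝ := ξ ^ 2 - ξ₁ ^ 2 + ξ₂ ^ 2 - ξ₃ ^ 2

/-- The trilinear operator `T^w_{|Φ|>M}`, defined on the Fourier side by
integrating `(|ξ₂|/⟨Φ(ξ̄)⟩) v̂₁(ξ₁) conj(v̂₂(ξ₂)) v̂₃(ξ₃)` over the hyperplane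
`ξ = ξ₁ - ξ₂ + ξ₃` restricted to `|Φ(ξ̄)| > M`, with `ξ₃ = ξ - ξ₁ + ξ₂`. -/
noncomputable def TwAbove (M : ℝ) (v₁ v₂ v₃ : ℝ → ℂ) : ℝ → ℂ :=
  𝓕⁻ fun ξ : ℝ => ∫ ξ₁ : ℝ, ∫ ξ₂ : ℝ,
    (if M < |modPhi ξ ξ₁ ξ₂ (ξ - ξ₁ + ξ₂)| then
        ((|ξ₂| / jb (modPhi ξ ξ₁ ξ₂ (ξ - ξ₁ + ξ₂)) : ℝ) : ℂ)
      else 0) *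
      𝓕 v₁ ξ₁ * (starRingEnd ℂ) (𝓕 v₂ ξ₂) * 𝓕 v₃ (ξ - ξ₁ + ξ₂)

/-! ### The Japanese bracket -/

lemma jb_eq_sqrt (x : ℝ) : jb x = √(1 + x ^ 2) := by
  rw [jb, Real.sqrt_eq_rpow]

lemma continuous_jb : Continuous jb := by
  simp only [funext jb_eq_sqrt]; fun_prop

lemma one_le_jb (x : ℝ) : 1 ≤ jb x := by
  rw [jb_eq_sqrt]; exact Real.one_le_sqrt.2 (by nlinarith)

lemma jb_pos (x : ℝ) : 0 < jb x := one_pos.trans_le (one_le_jb x)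

lemma abs_le_jb (x : ℝ) : |x| ≤ jb x := by
  rw [jb_eq_sqrt]; exact Real.abs_le_sqrt (by linarith)

lemma jb_le_add_abs_sub (x y : ℝ) : jb x ≤ jb y + |x - y| := by
  have hy := abs_le_jb y
  have hy0 := jb_pos y
  have hsq : jb y ^ 2 = 1 + y ^ 2 := by
    rw [jb_eq_sqrt]; exact Real.sq_sqrt (by positivity)
  rw [jb_eq_sqrt x]
  refine Real.sqrt_le_iff.2 ⟨by positivity, ?_⟩
  have h1 : y * (x - y) ≤ jb y * |x - y| :=
    (le_abs_self _).trans (by rw [abs_mul]; gcongr)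
  nlinarith [sq_abs (x - y)]

lemma jb_le_one_add_abs (x : ℝ) : jb x ≤ 1 + |x| := by
  simpa [jb] using jb_le_add_abs_sub x 0

lemma jb_sub_add_le (x y z : ℝ) : jb (x - y + z) ≤ 3 * (jb x * jb y * jb z) := by
  have h0 := jb_le_add_abs_sub (x - y + z) x
  have h1 : |x - y + z - x| ≤ |y| + |z| := by
    rw [show x - y + z - x = z - y by ring]
    linarith [abs_sub z y]
  have hx := one_le_jb x
  have hy := one_le_jb y
  have hz := one_le_jb z
  have hxy : 1 ≤ jb x * jb y := one_le_mul_of_one_le_of_one_le hx hy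
  have hyz : 1 ≤ jb y * jb z := one_le_mul_of_one_le_of_one_le hy hz
  have hxz : 1 ≤ jb x * jb z := one_le_mul_of_one_le_of_one_le hx hz
  nlinarith [abs_le_jb y, abs_le_jb z]

/-! ### Pointwise bounds for the multiplier

All sizes are recorded through their logarithms: `l₀, l₁, l₂, l₃` stand for the logarithms of the
brackets of the four frequencies, `a, b` for those of `|ξ₃ - ξ₂|`, `|ξ₁ - ξ₂|`, and `la, lb` for
those of the corresponding brackets. -/

/-- The logarithmic bound `w` is dominated, up to the constant `c`, by one of the kernels that
make up `majorant`. -/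
def LogDominated (t c w l₀ l₁ l₃ a b la lb : ℝ) : Prop :=
  w ≤ c - (1 - t) * l₁ - (1 - t) * l₃ ∨
  w ≤ c - (1 - t) * l₀ - (1 - t) * l₃ ∨
  w ≤ c - (1 - t) * l₀ - (1 - t) * l₁ ∨
  w ≤ c - (1 - t) * l₃ - (1 - t) * lb ∨
  w ≤ c - (1 - t) * l₁ - (1 - t) * la ∨
  w ≤ c - (1 - t) * la - (1 - t) * lb ∨
  (b ≤ 0 ∧ w ≤ c - 2 * t * b) ∨
  (a ≤ 0 ∧ w ≤ c - 2 * t * a) ∨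
  w ≤ c - (1 - t) * l₃ - (1 - t) * la ∨
  w ≤ c - (1 - t) * l₁ - (1 - t) * lb

lemma LogDominated.swap {t c w l₀ l₁ l₃ a b la lb : ℝ}
    (h : LogDominated t c w l₀ l₁ l₃ a b la lb) : LogDominated t c w l₀ l₃ l₁ b a lb la := by
  unfold LogDominated at *
  rcases h with h | h | h | h | h | h | h | h | h | h
  · left; linarith
  · right; right; left; linarith
  · right; left; linarith
  · right; right; right; right; left; linarith
  · right; right; right; left; linarith
  · right; right; right; right; right; left; linarith
  · tauto
  · tauto
  · tauto
  · tauto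

lemma LogDominated.mono {t c c' w w' l₀ l₁ l₃ a b la lb : ℝ}
    (h : LogDominated t c w l₀ l₁ l₃ a b la lb) (hw : w' - c' ≤ w - c) :
    LogDominated t c' w' l₀ l₁ l₃ a b la lb := by
  unfold LogDominated at *
  rcases h with h | h | h | h | h | h | h | h | h | h
  · left; linarith
  · right; left; linarith
  · right; right; left; linarith
  · right; right; right; left; linarith
  · right; right; right; right; left; linarith
  · right; right; right; right; right; left; linarith
  · right; right; right; right; right; right; left; exact ⟨h.1, by linarith⟩
  · right; right; right; right; right; right; right; left; exact ⟨h.1, by linarith⟩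
  · right; right; right; right; right; right; right; right; left; linarith
  · right; right; right; right; right; right; right; right; right; linarith

/-- The relations between the logarithmic sizes forced by `ξ = ξ₁ - ξ₂ + ξ₃`,
up to the constant `L`. -/
structure LogSizes (L l₀ l₁ l₂ l₃ a b la lb : ℝ) : Prop where
  L_nonneg : 0 ≤ L
  l₀_nonneg : 0 ≤ l₀
  l₁_nonneg : 0 ≤ l₁
  l₂_nonneg : 0 ≤ l₂
  l₃_nonneg : 0 ≤ l₃
  le_l₃ : a ≤ l₂ - L → l₂ - L ≤ l₃
  le_l₁ : b ≤ l₂ - L → l₂ - L ≤ l₁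
  le_l₀ : a ≤ l₂ - L → b ≤ l₂ - L → l₂ - L ≤ l₀
  le_l₁_or_le_l₃ : l₀ ≤ l₂ - L → l₂ - L ≤ l₁ ∨ l₂ - L ≤ l₃
  le_b : l₂ + L ≤ l₁ → l₁ - L ≤ b
  le_a : l₂ + L ≤ l₃ → l₃ - L ≤ a
  la_le : 0 ≤ a → la ≤ a + L
  lb_le : 0 ≤ b → lb ≤ b + L
  modulation : -L ≤ a + b

lemma LogSizes.swap {L l₀ l₁ l₂ l₃ a b la lb : ℝ} (h : LogSizes L l₀ l₁ l₂ l₃ a b la lb) :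
    LogSizes L l₀ l₃ l₂ l₁ b a lb la where
  L_nonneg := h.L_nonneg
  l₀_nonneg := h.l₀_nonneg
  l₁_nonneg := h.l₃_nonneg
  l₂_nonneg := h.l₂_nonneg
  l₃_nonneg := h.l₁_nonneg
  le_l₃ := h.le_l₁
  le_l₁ := h.le_l₃
  le_l₀ h1 h2 := h.le_l₀ h2 h1
  le_l₁_or_le_l₃ h1 := (h.le_l₁_or_le_l₃ h1).symm
  le_b := h.le_a
  le_a := h.le_b
  la_le := h.lb_le
  lb_le := h.la_le
  modulation := by linarith [h.modulation]

lemma LogSizes.logDominated_of_le {t L l₀ l₁ l₂ l₃ a b la lb : ℝ} (ht : 1 / 4 ≤ t) (ht' : t < 1 / 2)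
    (h : LogSizes L l₀ l₁ l₂ l₃ a b la lb) (hab : b ≤ a) :
    LogDominated t (8 * L) (-t * l₀ + (1 + t) * l₂ - (1 - t) * l₁ - (1 - t) * l₃
      - 2 * t * a - 2 * t * b) l₀ l₁ l₃ a b la lb := by
  obtain ⟨hL, h0, h1, h2, h3, hl3, hl1, hl0, hl13, -, -, hla, hlb, hm⟩ := h
  have ht0 : 0 ≤ t := by linarith
  have hs0 : 0 ≤ 1 - t := by linarith
  have htL : 0 ≤ t * L := by positivity
  have htL2 : t * L ≤ L / 2 := by nlinarith
  have h4t : 0 ≤ 4 * t - 1 := by linarith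
  unfold LogDominated
  by_cases hA : l₂ - L ≤ a
  · have mA := mul_nonneg ht0 (sub_nonneg.2 hA)
    by_cases hB : b ≤ l₂ - L
    · have m1 := mul_nonneg hs0 (sub_nonneg.2 (hl1 hB))
      have m0 := mul_nonneg ht0 h0
      have m3 := mul_nonneg hs0 h3
      by_cases hb : b ≤ 0
      · right; right; right; right; right; right; left
        exact ⟨hb, by linarith⟩
      · push Not at hb
        by_cases h0b : l₀ ≤ b
        · right; left
          have := mul_nonneg ht0 (sub_nonneg.2 h0b)
          have := mul_nonneg h4t h0
          linarith
        · right; right; right; left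
          have := mul_nonneg ht0 (sub_nonneg.2 (not_le.1 h0b).le)
          have := mul_nonneg h4t hb.le
          have := mul_nonneg hs0 (sub_nonneg.2 (hlb hb.le))
          linarith
    · have mB := mul_nonneg ht0 (sub_nonneg.2 (not_le.1 hB).le)
      by_cases h02 : l₀ ≤ l₂ - L
      · have m02 := mul_nonneg ht0 (sub_nonneg.2 h02)
        have := mul_nonneg h4t h0
        rcases hl13 h02 with h' | h'
        · right; left
          have := mul_nonneg hs0 (sub_nonneg.2 h')
          linarith
        · right; right; left
          have := mul_nonneg hs0 (sub_nonneg.2 h')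
          linarith
      · left
        have m02 := mul_nonneg ht0 (sub_nonneg.2 (not_le.1 h02).le)
        have := mul_nonneg h4t h2
        linarith
  · push Not at hA
    have hB : b ≤ l₂ - L := hab.trans hA.le
    have m3 := mul_nonneg hs0 (sub_nonneg.2 (hl3 hA.le))
    have m1 := mul_nonneg hs0 (sub_nonneg.2 (hl1 hB))
    have m0 := mul_nonneg ht0 (sub_nonneg.2 (hl0 hA.le hB))
    have h12 : 0 ≤ 1 / 2 - t := by linarith
    by_cases hb : b ≤ 0
    · right; right; right; right; right; right; left
      have := mul_nonneg ht0 (show 0 ≤ a + L by linarith)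
      have := mul_nonneg h12 h2
      exact ⟨hb, by linarith⟩
    · push Not at hb
      right; right; right; right; right; left
      have ha : 0 ≤ a := hb.le.trans hab
      have := mul_nonneg hs0 (sub_nonneg.2 (hlb hb.le))
      have := mul_nonneg hs0 (sub_nonneg.2 (hla ha))
      have := mul_nonneg h12 (sub_nonneg.2 hA.le)
      have := mul_nonneg h12 (sub_nonneg.2 hB)
      have := mul_nonneg h4t ha
      have := mul_nonneg h4t hb.le
      have := mul_nonneg h12 hL
      linarith

lemma LogSizes.logDominated_mid {t L l₀ l₁ l₂ l₃ a b la lb : ℝ} (ht : 1 / 4 ≤ t) (ht' : t < 1 / 2)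
    (h : LogSizes L l₀ l₁ l₂ l₃ a b la lb) :
    LogDominated t (8 * L) (-t * l₀ + (1 + t) * l₂ - (1 - t) * l₁ - (1 - t) * l₃
      - 2 * t * a - 2 * t * b) l₀ l₁ l₃ a b la lb := by
  rcases le_total b a with hab | hab
  · exact h.logDominated_of_le ht ht' hab
  · exact (h.swap.logDominated_of_le ht ht' hab).swap.mono (by linarith)

lemma LogSizes.logDominated_left {t L l₀ l₁ l₂ l₃ a b la lb : ℝ} (ht : 1 / 4 ≤ t) (ht' : t < 1 / 2)
    (h : LogSizes L l₀ l₁ l₂ l₃ a b la lb) :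
    LogDominated t (9 * L) (-t * l₀ + t * l₂ + t * l₁ - (1 - t) * l₃
      - 2 * t * a - 2 * t * b) l₀ l₁ l₃ a b la lb := by
  by_cases h12 : l₁ ≤ l₂ + L
  · exact (h.logDominated_mid ht ht').mono (by linarith)
  push Not at h12
  obtain ⟨hL, h0, h1, h2, h3, -, -, -, -, hb, -, hla, -, -⟩ := h
  have ht0 : 0 ≤ t := by linarith
  have hs0 : 0 ≤ 1 - t := by linarith
  have htL : 0 ≤ t * L := by positivity
  have htL2 : t * L ≤ L / 2 := by nlinarith
  have h4t : 0 ≤ 4 * t - 1 := by linarith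
  have mb := mul_nonneg ht0 (sub_nonneg.2 (hb h12.le))
  have m12 := mul_nonneg ht0 (sub_nonneg.2 h12.le)
  have m0 := mul_nonneg ht0 h0
  have m3 := mul_nonneg hs0 h3
  unfold LogDominated
  by_cases ha : a ≤ 0
  · right; right; right; right; right; right; right; left
    exact ⟨ha, by linarith⟩
  push Not at ha
  by_cases h0a : l₀ ≤ a
  · right; left
    have := mul_nonneg ht0 (sub_nonneg.2 h0a)
    have := mul_nonneg h4t h0
    linarith
  · right; right; right; right; right; right; right; right; left
    have := mul_nonneg ht0 (sub_nonneg.2 (not_le.1 h0a).le)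
    have := mul_nonneg h4t ha.le
    have := mul_nonneg hs0 (sub_nonneg.2 (hla ha.le))
    linarith

lemma logSizes_of_frequencies {x y z : ℝ} (h : 1 / 2 < |(z - y) * (x - y)|) :
    LogSizes (Real.log 4) (Real.log (jb (x - y + z))) (Real.log (jb x)) (Real.log (jb y))
      (Real.log (jb z)) (Real.log |z - y|) (Real.log |x - y|) (Real.log (jb (z - y)))
      (Real.log (jb (x - y))) := by
  have hne : (z - y) * (x - y) ≠ 0 := by
    intro h0; rw [h0, abs_zero] at h; norm_num at h
  have ha : 0 < |z - y| := abs_pos.2 (left_ne_zero_of_mul hne)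
  have hb : 0 < |x - y| := abs_pos.2 (right_ne_zero_of_mul hne)
  have le_sub {X Y : ℝ} (hX : 0 < X) (hY : 0 < Y) :
      Real.log X ≤ Real.log Y - Real.log 4 ↔ X ≤ Y / 4 := by
    rw [← Real.log_div hY.ne' (by norm_num), Real.log_le_log_iff hX (by positivity)]
  have sub_le {X Y : ℝ} (hX : 0 < X) (hY : 0 < Y) :
      Real.log Y - Real.log 4 ≤ Real.log X ↔ Y / 4 ≤ X := by
    rw [← Real.log_div hY.ne' (by norm_num), Real.log_le_log_iff (by positivity) hX]
  have add_le {X Y : ℝ} (hX : 0 < X) (hY : 0 < Y) :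
      Real.log Y + Real.log 4 ≤ Real.log X ↔ Y * 4 ≤ X := by
    rw [← Real.log_mul hY.ne' (by norm_num), Real.log_le_log_iff (by positivity) hX]
  have le_add {X Y : ℝ} (hX : 0 < X) (hY : 0 < Y) :
      Real.log X ≤ Real.log Y + Real.log 4 ↔ X ≤ Y * 4 := by
    rw [← Real.log_mul hY.ne' (by norm_num), Real.log_le_log_iff hX (by positivity)]
  have hx1 := one_le_jb x
  have hy1 := one_le_jb y
  have hz1 := one_le_jb z
  have h01 := one_le_jb (x - y + z)
  have hyz := jb_le_add_abs_sub y z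
  have hyx := jb_le_add_abs_sub y x
  have hxy := jb_le_add_abs_sub x y
  have hzy := jb_le_add_abs_sub z y
  rw [abs_sub_comm] at hyz hyx
  have hy0 : jb y ≤ jb (x - y + z) + (|x - y| + |z - y|) := by
    refine (jb_le_add_abs_sub y (x - y + z)).trans ?_
    gcongr
    rw [show y - (x - y + z) = (y - x) + (y - z) by ring, abs_sub_comm x y, abs_sub_comm z y]
    exact abs_add_le _ _
  refine ⟨Real.log_nonneg (by norm_num), Real.log_nonneg (one_le_jb _),
    Real.log_nonneg (one_le_jb _), Real.log_nonneg (one_le_jb _), Real.log_nonneg (one_le_jb _),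
    ?_, ?_, ?_, ?_, ?_, ?_, ?_, ?_, ?_⟩
  · rw [le_sub ha (jb_pos _), sub_le (jb_pos _) (jb_pos _)]
    intro; linarith
  · rw [le_sub hb (jb_pos _), sub_le (jb_pos _) (jb_pos _)]
    intro; linarith
  · rw [le_sub ha (jb_pos _), sub_le (jb_pos _) (jb_pos _), le_sub hb (jb_pos _)]
    intros; linarith
  · rw [le_sub (jb_pos _) (jb_pos _), sub_le (jb_pos _) (jb_pos _), sub_le (jb_pos _) (jb_pos _)]
    intro h0
    by_contra! hcon
    have e1 := jb_le_one_add_abs y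
    have e2 : |y| ≤ |x| + |z| + |x - y + z| := by
      have : y = (x + z) - (x - y + z) := by ring
      calc |y| = |(x + z) - (x - y + z)| := by rw [← this]
        _ ≤ |x + z| + |x - y + z| := abs_sub _ _
        _ ≤ _ := by gcongr; exact abs_add_le _ _
    linarith [abs_le_jb x, abs_le_jb z, abs_le_jb (x - y + z)]
  · rw [add_le (jb_pos _) (jb_pos _), sub_le hb (jb_pos _)]
    intro; linarith
  · rw [add_le (jb_pos _) (jb_pos _), sub_le ha (jb_pos _)]
    intro; linarith
  · rw [← Real.log_one, Real.log_le_log_iff one_pos ha, le_add (jb_pos _) ha]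
    intro; linarith [jb_le_one_add_abs (z - y)]
  · rw [← Real.log_one, Real.log_le_log_iff one_pos hb, le_add (jb_pos _) hb]
    intro; linarith [jb_le_one_add_abs (x - y)]
  · rw [← Real.log_mul ha.ne' hb.ne', ← Real.log_inv, ← abs_mul]
    exact Real.log_le_log (by norm_num) (by linarith)

/-- The truncated Riesz kernel `|x|^{-2t}` on `|x| ≤ 1`. -/
noncomputable def rieszKernel (t x : ℝ) : ℝ := if |x| ≤ 1 then |x| ^ (-(2 * t)) else 0

/-- The inverse bracket weight `⟨x⟩^{-(1-t)}`. -/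
noncomputable def decay (t x : ℝ) : ℝ := jb x ^ (-(1 - t))

/-- The sum of elementary kernels that dominates the normalized multiplier. -/
noncomputable def majorant (t x y z : ℝ) : ℝ :=
  decay t x * decay t z + decay t z * decay t (x - y + z) + decay t x * decay t (x - y + z) +
    decay t z * decay t (x - y) + decay t x * decay t (z - y) +
    decay t (z - y) * decay t (x - y) + rieszKernel t (x - y) + rieszKernel t (z - y) +
    decay t z * decay t (z - y) + decay t x * decay t (x - y)

lemma decay_nonneg (t x : ℝ) : 0 ≤ decay t x := Real.rpow_nonneg (jb_pos x).le _

lemma rieszKernel_nonneg (t x : ℝ) : 0 ≤ rieszKernel t x := by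
  unfold rieszKernel; split_ifs <;> positivity

lemma decay_eq_exp (t x : ℝ) : decay t x = Real.exp (-(1 - t) * Real.log (jb x)) := by
  rw [decay, Real.rpow_def_of_pos (jb_pos x), mul_comm]

lemma rieszKernel_eq_exp {t x : ℝ} (hx : x ≠ 0) (h : Real.log |x| ≤ 0) :
    rieszKernel t x = Real.exp (-(2 * t) * Real.log |x|) := by
  have hx' : 0 < |x| := abs_pos.2 hx
  have : |x| ≤ 1 := (Real.log_nonpos_iff hx'.le).1 h
  rw [rieszKernel, if_pos this, Real.rpow_def_of_pos hx', mul_comm]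

lemma exp_le_majorant {t c w x y z : ℝ} (hxy : x - y ≠ 0) (hzy : z - y ≠ 0)
    (h : LogDominated t c w (Real.log (jb (x - y + z))) (Real.log (jb x)) (Real.log (jb z))
      (Real.log |z - y|) (Real.log |x - y|) (Real.log (jb (z - y))) (Real.log (jb (x - y)))) :
    Real.exp w ≤ Real.exp c * majorant t x y z := by
  have d := decay_nonneg t
  have d2 (u v : ℝ) : 0 ≤ decay t u * decay t v := mul_nonneg (d u) (d v)
  have r := rieszKernel_nonneg t
  have key {u v : ℝ} (h : w ≤ c - (1 - t) * Real.log (jb u) - (1 - t) * Real.log (jb v)) :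
      Real.exp w ≤ Real.exp c * (decay t u * decay t v) := by
    rw [decay_eq_exp, decay_eq_exp, ← Real.exp_add, ← Real.exp_add]
    exact Real.exp_le_exp.2 (by linarith)
  have key' {u : ℝ} (hu : u ≠ 0)
      (h : Real.log |u| ≤ 0 ∧ w ≤ c - 2 * t * Real.log |u|) :
      Real.exp w ≤ Real.exp c * rieszKernel t u := by
    rw [rieszKernel_eq_exp hu h.1, ← Real.exp_add]
    exact Real.exp_le_exp.2 (by linarith)
  unfold majorant
  have n1 := d2 x z
  have n2 := d2 z (x - y + z)
  have n3 := d2 x (x - y + z)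
  have n4 := d2 z (x - y)
  have n5 := d2 x (z - y)
  have n6 := d2 (z - y) (x - y)
  have n7 := r (x - y)
  have n8 := r (z - y)
  have n9 := d2 z (z - y)
  have n10 := d2 x (x - y)
  rcases h with h | h | h | h | h | h | h | h | h | h
  · refine (key h).trans ?_; gcongr; linarith
  · refine (key (u := z) (v := x - y + z) (by linarith)).trans ?_; gcongr; linarith
  · refine (key (u := x) (v := x - y + z) (by linarith)).trans ?_; gcongr; linarith
  · refine (key h).trans ?_; gcongr; linarith
  · refine (key h).trans ?_; gcongr; linarith
  · refine (key h).trans ?_; gcongr; linarith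
  · refine (key' hxy h).trans ?_; gcongr; linarith
  · refine (key' hzy h).trans ?_; gcongr; linarith
  · refine (key h).trans ?_; gcongr; linarith
  · refine (key h).trans ?_; gcongr; linarith

lemma modPhi_eq (x y z : ℝ) : modPhi (x - y + z) x y z = 2 * ((z - y) * (x - y)) := by
  unfold modPhi; ring

lemma multiplier_le {s t M : ℝ} (hs : 1 / 2 < s) (ht : t = 1 - min s (3 / 4)) (hM : 1 ≤ M)
    (j : Fin 3) {e : Fin 3 → ℝ} (he : ∀ i, e i = if i = j then s - 1 else s) {x y z : ℝ}
    (h : M < |modPhi (x - y + z) x y z|) :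
    jb (x - y + z) ^ (s - 1) * (|y| / jb (modPhi (x - y + z) x y z)) ≤
      Real.exp (9 * Real.log 4 + s * Real.log 3) * M ^ (-(min (2 * s - 1) (1 / 2))) *
        (jb x ^ e 0 * jb y ^ e 1 * jb z ^ e 2) * majorant t x y z := by
  have ht1 : 1 / 4 ≤ t := by rw [ht]; linarith [min_le_right s (3 / 4)]
  have ht2 : t < 1 / 2 := by
    rw [ht]; linarith [lt_min hs (show (1 : ℝ) / 2 < 3 / 4 by norm_num)]
  have hst : 0 ≤ s - (1 - t) := by rw [ht]; linarith [min_le_left s (3 / 4)]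
  have hθ : min (2 * s - 1) (1 / 2) = 1 - 2 * t := by
    rw [ht]; rcases le_total s (3 / 4) with h' | h'
    · rw [min_eq_left h', min_eq_left (by linarith)]; ring
    · rw [min_eq_right h', min_eq_right (by linarith)]; ring
  rw [hθ]
  have hΦ0 : 0 < |modPhi (x - y + z) x y z| := by linarith
  have hΦ : |modPhi (x - y + z) x y z| = 2 * |(z - y) * (x - y)| := by
    rw [modPhi_eq, abs_mul, abs_two]
  have hab : 1 / 2 < |(z - y) * (x - y)| := by linarith
  have hne : (z - y) * (x - y) ≠ 0 := by
    intro h0; rw [h0, abs_zero] at hab; norm_num at hab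
  have hzy := left_ne_zero_of_mul hne
  have hxy := right_ne_zero_of_mul hne
  have hlogΦ : Real.log |modPhi (x - y + z) x y z| =
      Real.log 2 + (Real.log |z - y| + Real.log |x - y|) := by
    rw [hΦ, Real.log_mul two_ne_zero (abs_ne_zero.2 hne), abs_mul,
      Real.log_mul (abs_ne_zero.2 hzy) (abs_ne_zero.2 hxy)]
  have hlogM : Real.log M ≤ Real.log |modPhi (x - y + z) x y z| :=
    Real.log_le_log (by linarith) h.le
  have hsizes := logSizes_of_frequencies hab
  have h0 : Real.log (jb (x - y + z)) ≤
      Real.log 3 + (Real.log (jb x) + Real.log (jb y) + Real.log (jb z)) := by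
    have hx := jb_pos x
    have hy := jb_pos y
    have hz := jb_pos z
    rw [← Real.log_mul hx.ne' hy.ne', ← Real.log_mul (by positivity) hz.ne',
      ← Real.log_mul (by norm_num) (by positivity)]
    exact Real.log_le_log (jb_pos _) (jb_sub_add_le x y z)
  have hl2 : 0 ≤ Real.log 2 := Real.log_nonneg (by norm_num)
  have hl3 : 0 ≤ Real.log 3 := Real.log_nonneg (by norm_num)
  have hl4 : 0 ≤ Real.log 4 := Real.log_nonneg (by norm_num)
  have hlhs : jb (x - y + z) ^ (s - 1) * (|y| / jb (modPhi (x - y + z) x y z)) ≤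
      Real.exp ((s - 1) * Real.log (jb (x - y + z)) + (Real.log (jb y) -
        Real.log |modPhi (x - y + z) x y z|)) := by
    rw [Real.exp_add, Real.exp_sub, Real.exp_log (jb_pos y), Real.exp_log hΦ0,
      Real.rpow_def_of_pos (jb_pos _), mul_comm (Real.log _)]
    have := jb_pos y
    have := abs_le_jb y
    have := abs_le_jb (modPhi (x - y + z) x y z)
    gcongr
  refine hlhs.trans ?_
  have hdom : LogDominated t (9 * Real.log 4 + s * Real.log 3)
      ((s - 1) * Real.log (jb (x - y + z)) + (Real.log (jb y) -
        Real.log |modPhi (x - y + z) x y z|) + (1 - 2 * t) * Real.log M -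
        (e 0 * Real.log (jb x) + e 1 * Real.log (jb y) + e 2 * Real.log (jb z)))
      (Real.log (jb (x - y + z))) (Real.log (jb x)) (Real.log (jb z))
      (Real.log |z - y|) (Real.log |x - y|) (Real.log (jb (z - y))) (Real.log (jb (x - y))) := by
    have m1 := mul_nonneg hst (sub_nonneg.2 h0)
    have m2 := mul_nonneg (show 0 ≤ 1 - 2 * t by linarith) (sub_nonneg.2 hlogM)
    have m3 := mul_nonneg (show 0 ≤ 1 - t by linarith) hl3
    have m4 := mul_nonneg (show 0 ≤ t by linarith) hl2
    rw [hlogΦ] at m2 ⊢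
    have he0 := he 0
    have he1 := he 1
    have he2 := he 2
    fin_cases j <;> simp at he0 he1 he2 <;> rw [he0, he1, he2]
    · refine (hsizes.logDominated_left ht1 ht2).mono ?_; linarith
    · refine (hsizes.logDominated_mid ht1 ht2).mono ?_; linarith
    · refine (hsizes.swap.logDominated_left ht1 ht2).swap.mono ?_; linarith
  have := exp_le_majorant hxy hzy hdom
  rw [Real.exp_sub, div_le_iff₀ (Real.exp_pos _), Real.exp_add _ ((1 - 2 * t) * _),
    ← le_div_iff₀ (Real.exp_pos _)] at this
  refine this.trans (le_of_eq ?_)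
  rw [Real.exp_add (e 0 * _ + _), Real.exp_add (e 0 * _)]
  simp only [Real.rpow_def_of_pos (jb_pos _), Real.rpow_def_of_pos (show 0 < M by linarith)]
  rw [div_eq_mul_inv, ← Real.exp_neg, mul_comm (Real.log M)]
  simp only [mul_comm (Real.log (jb _)), neg_mul]
  ring

/-! ### Trilinear forms bounded on `L²` -/

open scoped ENNReal

/-- The trilinear operator on the hyperplane `ξ = x - y + z` with kernel `K` is bounded from
`L² × L² × L²` to `L²`. -/
def IsBoundedKernel (K : ℝ × ℝ × ℝ → ℝ≥0∞) : Prop :=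
  ∃ D : ℝ≥0∞, D ≠ ∞ ∧ ∀ g₁ g₂ g₃ : ℝ → ℝ≥0∞, Measurable g₁ → Measurable g₂ → Measurable g₃ →
    ∫⁻ ξ, (∫⁻ x, ∫⁻ y, K (x, y, ξ - x + y) * (g₁ x * g₂ y * g₃ (ξ - x + y))) ^ 2 ≤
      D * ((∫⁻ x, g₁ x ^ 2) * (∫⁻ x, g₂ x ^ 2) * ∫⁻ x, g₃ x ^ 2)

lemma sq_lintegral_lintegral_mul_le {F G : ℝ × ℝ → ℝ≥0∞} (hF : Measurable F)
    (hG : Measurable G) :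
    (∫⁻ x, ∫⁻ y, F (x, y) * G (x, y)) ^ 2 ≤
      (∫⁻ x, ∫⁻ y, F (x, y) ^ 2) * ∫⁻ x, ∫⁻ y, G (x, y) ^ 2 := by
  rw [← lintegral_prod (fun p : ℝ × ℝ => F p * G p) (by fun_prop),
    ← lintegral_prod (fun p : ℝ × ℝ => F p ^ 2) (by fun_prop),
    ← lintegral_prod (fun p : ℝ × ℝ => G p ^ 2) (by fun_prop)]
  have h := ENNReal.lintegral_mul_le_Lp_mul_Lq ((volume : Measure ℝ).prod (volume : Measure ℝ))
    Real.HolderConjugate.two_two hF.aemeasurable hG.aemeasurable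
  have hsq (a : ℝ≥0∞) : (a ^ (1 / 2 : ℝ)) ^ 2 = a := by
    rw [← ENNReal.rpow_natCast, ← ENNReal.rpow_mul]; norm_num
  calc _ ≤ _ := pow_le_pow_left₀ (zero_le) h 2
    _ = _ := by
      rw [mul_pow, hsq, hsq]
      simp only [ENNReal.rpow_ofNat]

lemma IsBoundedKernel.add {K K' : ℝ × ℝ × ℝ → ℝ≥0∞} (hm : Measurable K)
    (h : IsBoundedKernel K) (h' : IsBoundedKernel K') :
    IsBoundedKernel fun p => K p + K' p := by
  obtain ⟨D, hD, h⟩ := h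
  obtain ⟨D', hD', h'⟩ := h'
  refine ⟨2 * (D + D'), by finiteness, fun g₁ g₂ g₃ h₁ h₂ h₃ => ?_⟩
  have e (ξ : ℝ) : ∫⁻ x, ∫⁻ y, (K (x, y, ξ - x + y) + K' (x, y, ξ - x + y)) *
      (g₁ x * g₂ y * g₃ (ξ - x + y)) =
      (∫⁻ x, ∫⁻ y, K (x, y, ξ - x + y) * (g₁ x * g₂ y * g₃ (ξ - x + y))) +
        ∫⁻ x, ∫⁻ y, K' (x, y, ξ - x + y) * (g₁ x * g₂ y * g₃ (ξ - x + y)) := by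
    rw [← lintegral_add_left]
    · congr with x
      rw [← lintegral_add_left (by fun_prop)]
      simp only [add_mul]
    · exact Measurable.lintegral_prod_right'
        (f := fun p : ℝ × ℝ => K (p.1, p.2, ξ - p.1 + p.2) *
          (g₁ p.1 * g₂ p.2 * g₃ (ξ - p.1 + p.2))) (by fun_prop)
  have hsq (a b : ℝ≥0∞) : (a + b) ^ 2 ≤ 2 * (a ^ 2 + b ^ 2) := by
    have h := ENNReal.rpow_add_le_mul_rpow_add_rpow a b (p := 2) (by norm_num)
    rw [show (2 : ℝ) - 1 = 1 by norm_num, ENNReal.rpow_one] at h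
    simpa using h
  calc _ ≤ ∫⁻ ξ, 2 * ((∫⁻ x, ∫⁻ y, K (x, y, ξ - x + y) * (g₁ x * g₂ y * g₃ (ξ - x + y))) ^ 2 +
        (∫⁻ x, ∫⁻ y, K' (x, y, ξ - x + y) * (g₁ x * g₂ y * g₃ (ξ - x + y))) ^ 2) := by
        gcongr with ξ; rw [e]; exact hsq _ _
    _ ≤ 2 * (D * ((∫⁻ x, g₁ x ^ 2) * (∫⁻ x, g₂ x ^ 2) * ∫⁻ x, g₃ x ^ 2) +
        D' * ((∫⁻ x, g₁ x ^ 2) * (∫⁻ x, g₂ x ^ 2) * ∫⁻ x, g₃ x ^ 2)) := by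
        rw [lintegral_const_mul' _ _ (by finiteness), lintegral_add_left]
        · gcongr
          · exact h _ _ _ h₁ h₂ h₃
          · exact h' _ _ _ h₁ h₂ h₃
        · refine Measurable.pow_const (Measurable.lintegral_prod_right'
            (f := fun p : ℝ × ℝ => ∫⁻ y, K (p.2, y, p.1 - p.2 + y) *
              (g₁ p.2 * g₂ y * g₃ (p.1 - p.2 + y))) ?_) 2
          exact Measurable.lintegral_prod_right'
            (f := fun p : (ℝ × ℝ) × ℝ => K (p.1.2, p.2, p.1.1 - p.1.2 + p.2) *
              (g₁ p.1.2 * g₂ p.2 * g₃ (p.1.1 - p.1.2 + p.2))) (by fun_prop)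
    _ = _ := by ring

/-- The trilinear form is symmetric under the exchange of the first and third variable. -/
lemma IsBoundedKernel.swap {K : ℝ × ℝ × ℝ → ℝ≥0∞} (hm : Measurable K) (h : IsBoundedKernel K) :
    IsBoundedKernel fun p => K (p.2.2, p.2.1, p.1) := by
  obtain ⟨D, hD, h⟩ := h
  refine ⟨D, hD, fun g₁ g₂ g₃ h₁ h₂ h₃ => ?_⟩
  calc _ = ∫⁻ ξ, (∫⁻ x, ∫⁻ y, K (x, y, ξ - x + y) * (g₃ x * g₂ y * g₁ (ξ - x + y))) ^ 2 := by
        congr with ξ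
        congr 1
        rw [lintegral_lintegral_swap (Measurable.aemeasurable (by fun_prop))]
        symm
        rw [lintegral_lintegral_swap (Measurable.aemeasurable (by fun_prop))]
        refine lintegral_congr fun y => ?_
        rw [← lintegral_sub_left_eq_self _ (ξ + y)]
        refine lintegral_congr fun x => ?_
        rw [show ξ - (ξ + y - x) + y = x by ring, show ξ + y - x = ξ - x + y by ring]
        ring
    _ ≤ _ := h _ _ _ h₃ h₂ h₁
    _ = _ := by ring

lemma isBoundedKernel_of_mid {K : ℝ × ℝ × ℝ → ℝ≥0∞} (hm : Measurable K) {D : ℝ≥0∞} (hD : D ≠ ∞)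
    (h : ∀ y, ∫⁻ ξ, ∫⁻ x, K (x, y, ξ - x + y) ^ 2 ≤ D) : IsBoundedKernel K := by
  refine ⟨D, hD, fun g₁ g₂ g₃ h₁ h₂ h₃ => ?_⟩
  have cs (ξ : ℝ) : (∫⁻ x, ∫⁻ y, K (x, y, ξ - x + y) * (g₁ x * g₂ y * g₃ (ξ - x + y))) ^ 2 ≤
      (∫⁻ x, ∫⁻ y, (K (x, y, ξ - x + y) * g₂ y) ^ 2) *
        ((∫⁻ x, g₁ x ^ 2) * ∫⁻ x, g₃ x ^ 2) := by
    calc _ = (∫⁻ x, ∫⁻ y, (K (x, y, ξ - x + y) * g₂ y) * (g₁ x * g₃ (ξ - x + y))) ^ 2 := by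
          congr 1; exact lintegral_congr fun x => lintegral_congr fun y => by ring
      _ ≤ _ := sq_lintegral_lintegral_mul_le
          (F := fun p => K (p.1, p.2, ξ - p.1 + p.2) * g₂ p.2)
          (G := fun p => g₁ p.1 * g₃ (ξ - p.1 + p.2)) (by fun_prop) (by fun_prop)
      _ = _ := by
          congr 1
          simp only [mul_pow]
          rw [← lintegral_mul_const _ (by fun_prop)]
          congr with x
          rw [lintegral_const_mul _ (by fun_prop),
            lintegral_add_left_eq_self (fun y => g₃ y ^ 2)]
  calc _ ≤ _ := lintegral_mono cs
    _ = (∫⁻ y, g₂ y ^ 2 * ∫⁻ ξ, ∫⁻ x, K (x, y, ξ - x + y) ^ 2) *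
        ((∫⁻ x, g₁ x ^ 2) * ∫⁻ x, g₃ x ^ 2) := by
        rw [lintegral_mul_const]
        · congr 1
          have e (ξ : ℝ) : ∫⁻ x, ∫⁻ y, (K (x, y, ξ - x + y) * g₂ y) ^ 2 =
              ∫⁻ y, g₂ y ^ 2 * ∫⁻ x, K (x, y, ξ - x + y) ^ 2 := by
            rw [lintegral_lintegral_swap (Measurable.aemeasurable (by fun_prop))]
            congr with y
            rw [← lintegral_const_mul _ (by fun_prop)]
            congr with x
            ring
          simp only [e]
          have hmeas : Measurable fun p : ℝ × ℝ => ∫⁻ x, K (x, p.2, p.1 - x + p.2) ^ 2 :=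
            Measurable.lintegral_prod_right'
              (f := fun p : (ℝ × ℝ) × ℝ => K (p.2, p.1.2, p.1.1 - p.2 + p.1.2) ^ 2) (by fun_prop)
          rw [lintegral_lintegral_swap (Measurable.aemeasurable (by fun_prop))]
          congr with y
          rw [lintegral_const_mul]
          exact hmeas.comp (g := fun p : ℝ × ℝ => ∫⁻ x, K (x, p.2, p.1 - x + p.2) ^ 2)
            (measurable_id.prodMk measurable_const)
        · refine Measurable.lintegral_prod_right'
            (f := fun p : ℝ × ℝ => ∫⁻ y, (K (p.2, y, p.1 - p.2 + y) * g₂ y) ^ 2) ?_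
          exact Measurable.lintegral_prod_right'
            (f := fun p : (ℝ × ℝ) × ℝ => (K (p.1.2, p.2, p.1.1 - p.1.2 + p.2) * g₂ p.2) ^ 2)
            (by fun_prop)
    _ ≤ (∫⁻ y, g₂ y ^ 2 * D) * ((∫⁻ x, g₁ x ^ 2) * ∫⁻ x, g₃ x ^ 2) := by
        gcongr with y; exact h y
    _ = _ := by rw [lintegral_mul_const _ (by fun_prop)]; ring

lemma isBoundedKernel_of_left {K : ℝ × ℝ × ℝ → ℝ≥0∞} (hm : Measurable K) {D : ℝ≥0∞} (hD : D ≠ ∞)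
    (h : ∀ x, ∫⁻ ξ, ∫⁻ y, K (x, y, ξ - x + y) ^ 2 ≤ D) : IsBoundedKernel K := by
  refine ⟨D, hD, fun g₁ g₂ g₃ h₁ h₂ h₃ => ?_⟩
  have cs (ξ : ℝ) : (∫⁻ x, ∫⁻ y, K (x, y, ξ - x + y) * (g₁ x * g₂ y * g₃ (ξ - x + y))) ^ 2 ≤
      (∫⁻ x, g₁ x ^ 2 * ∫⁻ y, K (x, y, ξ - x + y) ^ 2) *
        ((∫⁻ x, g₂ x ^ 2) * ∫⁻ x, g₃ x ^ 2) := by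
    calc _ = (∫⁻ x, ∫⁻ y, (K (x, y, ξ - x + y) * g₁ x) * (g₂ y * g₃ (ξ - x + y))) ^ 2 := by
          congr 1; exact lintegral_congr fun x => lintegral_congr fun y => by ring
      _ ≤ _ := sq_lintegral_lintegral_mul_le
          (F := fun p => K (p.1, p.2, ξ - p.1 + p.2) * g₁ p.1)
          (G := fun p => g₂ p.2 * g₃ (ξ - p.1 + p.2)) (by fun_prop) (by fun_prop)
      _ = _ := by
          simp only [mul_pow]
          congr 1
          · congr with x
            rw [lintegral_mul_const _ (by fun_prop), mul_comm]
          rw [lintegral_lintegral_swap (Measurable.aemeasurable (by fun_prop)),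
            ← lintegral_mul_const _ (by fun_prop)]
          congr with y
          rw [lintegral_const_mul _ (by fun_prop), ← lintegral_sub_left_eq_self _ (ξ + y)]
          congr! 6; ring
  have hmeas : Measurable fun p : ℝ × ℝ => ∫⁻ y, K (p.2, y, p.1 - p.2 + y) ^ 2 :=
    Measurable.lintegral_prod_right'
      (f := fun p : (ℝ × ℝ) × ℝ => K (p.1.2, p.2, p.1.1 - p.1.2 + p.2) ^ 2) (by fun_prop)
  calc _ ≤ _ := lintegral_mono cs
    _ = (∫⁻ x, g₁ x ^ 2 * ∫⁻ ξ, ∫⁻ y, K (x, y, ξ - x + y) ^ 2) *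
        ((∫⁻ x, g₂ x ^ 2) * ∫⁻ x, g₃ x ^ 2) := by
        rw [lintegral_mul_const]
        · congr 1
          rw [lintegral_lintegral_swap (Measurable.aemeasurable (by fun_prop))]
          congr with x
          rw [lintegral_const_mul]
          exact hmeas.comp (g := fun p : ℝ × ℝ => ∫⁻ y, K (p.2, y, p.1 - p.2 + y) ^ 2)
            (measurable_id.prodMk measurable_const)
        · exact Measurable.lintegral_prod_right'
            (f := fun p : ℝ × ℝ => g₁ p.2 ^ 2 * ∫⁻ y, K (p.2, y, p.1 - p.2 + y) ^ 2)
            (by fun_prop)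
    _ ≤ (∫⁻ y, g₁ y ^ 2 * D) * ((∫⁻ x, g₂ x ^ 2) * ∫⁻ x, g₃ x ^ 2) := by
        gcongr with y; exact h y
    _ = _ := by rw [lintegral_mul_const _ (by fun_prop)]; ring

/-- An integrable function of `x - y` is a bounded kernel (Young's inequality). -/
lemma isBoundedKernel_sq_sub {q : ℝ → ℝ≥0∞} (hq : Measurable q) (hfin : ∫⁻ x, q x ^ 2 ≠ ∞) :
    IsBoundedKernel fun p => q (p.1 - p.2.1) ^ 2 := by
  refine ⟨(∫⁻ x, q x ^ 2) ^ 2, by finiteness, fun g₁ g₂ g₃ h₁ h₂ h₃ => ?_⟩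
  have cs (ξ : ℝ) : (∫⁻ x, ∫⁻ y, q (x - y) ^ 2 * (g₁ x * g₂ y * g₃ (ξ - x + y))) ^ 2 ≤
      (∫⁻ x, ∫⁻ y, (q (x - y) * g₁ x) ^ 2 * g₃ (ξ - x + y) ^ 2) *
        ((∫⁻ x, g₂ x ^ 2) * ∫⁻ x, q x ^ 2) := by
    calc _ = (∫⁻ x, ∫⁻ y, (q (x - y) * g₁ x * g₃ (ξ - x + y)) * (g₂ y * q (x - y))) ^ 2 := by
          congr 1; exact lintegral_congr fun x => lintegral_congr fun y => by ring
      _ ≤ _ := sq_lintegral_lintegral_mul_le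
          (F := fun p => q (p.1 - p.2) * g₁ p.1 * g₃ (ξ - p.1 + p.2))
          (G := fun p => g₂ p.2 * q (p.1 - p.2)) (by fun_prop) (by fun_prop)
      _ = _ := by
          congr 1
          · simp only [mul_pow]
          simp only [mul_pow]
          rw [lintegral_lintegral_swap (Measurable.aemeasurable (by fun_prop)),
            ← lintegral_mul_const _ (by fun_prop)]
          congr with y
          rw [lintegral_const_mul _ (by fun_prop),
            lintegral_sub_right_eq_self (fun y => q y ^ 2)]
  calc _ ≤ _ := lintegral_mono cs
    _ = ((∫⁻ x, g₁ x ^ 2) * (∫⁻ x, q x ^ 2) * ∫⁻ x, g₃ x ^ 2) *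
        ((∫⁻ x, g₂ x ^ 2) * ∫⁻ x, q x ^ 2) := by
        have hmeas : Measurable fun p : ℝ × ℝ =>
            ∫⁻ y, (q (p.2 - y) * g₁ p.2) ^ 2 * g₃ (p.1 - p.2 + y) ^ 2 :=
          Measurable.lintegral_prod_right'
            (f := fun p : (ℝ × ℝ) × ℝ =>
              (q (p.1.2 - p.2) * g₁ p.1.2) ^ 2 * g₃ (p.1.1 - p.1.2 + p.2) ^ 2) (by fun_prop)
        rw [lintegral_mul_const _ hmeas.lintegral_prod_right',
          lintegral_lintegral_swap hmeas.aemeasurable]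
        congr 1
        rw [mul_assoc, ← lintegral_mul_const _ (by fun_prop)]
        refine lintegral_congr fun x => ?_
        dsimp only
        calc _ = ∫⁻ y, (g₁ x ^ 2 * ∫⁻ z, g₃ z ^ 2) * q (x - y) ^ 2 := by
              rw [lintegral_lintegral_swap (Measurable.aemeasurable (by fun_prop))]
              refine lintegral_congr fun y => ?_
              rw [lintegral_const_mul _ (by fun_prop),
                ← lintegral_add_right_eq_self (fun z => g₃ z ^ 2) (y - x)]
              simp only [show ∀ z : ℝ, z + (y - x) = z - x + y from fun z => by ring]
              ring
          _ = _ := by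
              rw [lintegral_const_mul _ (by fun_prop),
                lintegral_sub_left_eq_self (fun y => q y ^ 2) x]
              ring
    _ = _ := by ring

section ProductKernels

variable {p q : ℝ → ℝ≥0∞}

lemma isBoundedKernel_left_right (hp : Measurable p) (hq : Measurable q)
    (hpf : ∫⁻ x, p x ^ 2 ≠ ∞) (hqf : ∫⁻ x, q x ^ 2 ≠ ∞) :
    IsBoundedKernel fun v => p v.1 * q v.2.2 := by
  refine isBoundedKernel_of_mid (by fun_prop) (ENNReal.mul_ne_top hpf hqf) fun y => le_of_eq ?_
  rw [lintegral_lintegral_swap (Measurable.aemeasurable (by fun_prop)),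
    ← lintegral_mul_const _ (by fun_prop)]
  refine lintegral_congr fun x => ?_
  simp only [mul_pow]
  rw [lintegral_const_mul _ (by fun_prop),
    ← lintegral_add_right_eq_self (fun z => q z ^ 2) (y - x)]
  simp only [show ∀ z : ℝ, z + (y - x) = z - x + y from fun z => by ring]

lemma isBoundedKernel_right_output (hp : Measurable p) (hq : Measurable q)
    (hpf : ∫⁻ x, p x ^ 2 ≠ ∞) (hqf : ∫⁻ x, q x ^ 2 ≠ ∞) :
    IsBoundedKernel fun v => p v.2.2 * q (v.1 - v.2.1 + v.2.2) := by
  refine isBoundedKernel_of_mid (by fun_prop) (ENNReal.mul_ne_top hpf hqf) fun y => le_of_eq ?_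
  rw [← lintegral_const_mul _ (by fun_prop)]
  refine lintegral_congr fun ξ => ?_
  simp only [mul_pow, show ∀ x : ℝ, x - y + (ξ - x + y) = ξ from fun x => by ring]
  rw [lintegral_mul_const _ (by fun_prop),
    ← lintegral_sub_left_eq_self (fun z => p z ^ 2) (ξ + y)]
  simp only [show ∀ x : ℝ, ξ + y - x = ξ - x + y from fun x => by ring]

lemma isBoundedKernel_right_sub (hp : Measurable p) (hq : Measurable q)
    (hpf : ∫⁻ x, p x ^ 2 ≠ ∞) (hqf : ∫⁻ x, q x ^ 2 ≠ ∞) :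
    IsBoundedKernel fun v => p v.2.2 * q (v.1 - v.2.1) := by
  refine isBoundedKernel_of_mid (by fun_prop) (ENNReal.mul_ne_top hpf hqf) fun y => le_of_eq ?_
  rw [lintegral_lintegral_swap (Measurable.aemeasurable (by fun_prop)),
    ← lintegral_sub_right_eq_self (fun z => q z ^ 2) y, ← lintegral_const_mul _ (by fun_prop)]
  refine lintegral_congr fun x => ?_
  simp only [mul_pow]
  rw [lintegral_mul_const _ (by fun_prop),
    ← lintegral_add_right_eq_self (fun z => p z ^ 2) (y - x)]
  simp only [show ∀ z : ℝ, z + (y - x) = z - x + y from fun z => by ring]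

lemma isBoundedKernel_sub_sub (hp : Measurable p) (hq : Measurable q)
    (hpf : ∫⁻ x, p x ^ 2 ≠ ∞) (hqf : ∫⁻ x, q x ^ 2 ≠ ∞) :
    IsBoundedKernel fun v => p (v.2.2 - v.2.1) * q (v.1 - v.2.1) := by
  refine isBoundedKernel_of_mid (by fun_prop) (ENNReal.mul_ne_top hpf hqf) fun y => le_of_eq ?_
  rw [lintegral_lintegral_swap (Measurable.aemeasurable (by fun_prop)),
    ← lintegral_sub_right_eq_self (fun z => q z ^ 2) y, ← lintegral_const_mul _ (by fun_prop)]
  refine lintegral_congr fun x => ?_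
  simp only [mul_pow, add_sub_cancel_right]
  rw [lintegral_mul_const _ (by fun_prop),
    ← lintegral_sub_right_eq_self (fun z => p z ^ 2) x]

lemma isBoundedKernel_right_sub_right (hp : Measurable p) (hq : Measurable q)
    (hpf : ∫⁻ x, p x ^ 2 ≠ ∞) (hqf : ∫⁻ x, q x ^ 2 ≠ ∞) :
    IsBoundedKernel fun v => p v.2.2 * q (v.2.2 - v.2.1) := by
  refine isBoundedKernel_of_left (by fun_prop) (ENNReal.mul_ne_top hpf hqf) fun x => le_of_eq ?_
  rw [← lintegral_sub_right_eq_self (fun z => q z ^ 2) x, ← lintegral_const_mul _ (by fun_prop)]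
  refine lintegral_congr fun ξ => ?_
  simp only [mul_pow, add_sub_cancel_right]
  rw [lintegral_mul_const _ (by fun_prop),
    ← lintegral_add_left_eq_self (fun z => p z ^ 2) (ξ - x)]

end ProductKernels

lemma measurable_decay (t : ℝ) : Measurable (decay t) :=
  continuous_jb.measurable.pow_const _

lemma measurable_rieszKernel (t : ℝ) : Measurable (rieszKernel t) :=
  Measurable.ite (measurableSet_le (by fun_prop) (by fun_prop)) (by fun_prop) measurable_const

lemma lintegral_decay_sq_ne_top {t : ℝ} (ht : t < 1 / 2) :
    ∫⁻ x, ENNReal.ofReal (decay t x) ^ 2 ≠ ∞ := by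
  have h := integrable_rpow_neg_one_add_norm_sq (E := ℝ) (μ := volume) (r := 2 * (1 - t))
    (by simp; linarith)
  convert! h.lintegral_lt_top.ne using 2 with x
  ext x
  rw [← ENNReal.ofReal_pow (decay_nonneg t x), decay, jb, ← Real.rpow_natCast,
    ← Real.rpow_mul (by positivity), ← Real.rpow_mul (by positivity), Real.norm_eq_abs, sq_abs]
  congr 2
  push_cast
  ring

lemma integrable_rieszKernel {t : ℝ} (ht : t < 1 / 2) : Integrable (rieszKernel t) := by
  have h : IntegrableOn (fun x : ℝ => x ^ (-(2 * t))) (Set.Ioc 0 1) := by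
    rw [← intervalIntegrable_iff_integrableOn_Ioc_of_le zero_le_one]
    exact intervalIntegral.intervalIntegrable_rpow' (by linarith)
  have h' : IntegrableOn (rieszKernel t) (Set.Ioi 0) := by
    rw [← Set.Ioc_union_Ioi_eq_Ioi zero_le_one, integrableOn_union]
    constructor
    · refine h.congr_fun (fun x hx => ?_) measurableSet_Ioc
      simp [rieszKernel, abs_of_pos hx.1, hx.2]
    · refine integrableOn_zero.congr_fun (fun x hx => ?_) measurableSet_Ioi
      have hx : 1 < x := hx
      simp [rieszKernel, abs_of_pos (zero_lt_one.trans hx), hx]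
  have heven : IntegrableOn (rieszKernel t) (Set.Iic 0) := by
    have m : MeasurableEmbedding (Neg.neg : ℝ → ℝ) := (Homeomorph.neg ℝ).measurableEmbedding
    rw [← Measure.map_neg_eq_self (volume : Measure ℝ), m.integrableOn_map_iff]
    simpa [Function.comp_def, rieszKernel] using! (integrableOn_Ici_iff_integrableOn_Ioi (by finiteness)).2 h'
  rw [← integrableOn_univ, ← Set.Iic_union_Ioi (a := (0 : ℝ))]
  exact heven.union h'

lemma isBoundedKernel_majorant {t : ℝ} (ht : t < 1 / 2) :
    IsBoundedKernel fun v => ENNReal.ofReal (majorant t v.1 v.2.1 v.2.2) := by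
  set d : ℝ → ℝ≥0∞ := fun x => ENNReal.ofReal (decay t x) with hd
  set r : ℝ → ℝ≥0∞ := fun x => ENNReal.ofReal √(rieszKernel t x) with hr
  have hdm : Measurable d := (measurable_decay t).ennreal_ofReal
  have hrm : Measurable r := (measurable_rieszKernel t).sqrt.ennreal_ofReal
  have hdf : ∫⁻ x, d x ^ 2 ≠ ∞ := lintegral_decay_sq_ne_top ht
  have hr2 (x : ℝ) : r x ^ 2 = ENNReal.ofReal (rieszKernel t x) := by
    rw [hr, ← ENNReal.ofReal_pow (Real.sqrt_nonneg _), Real.sq_sqrt (rieszKernel_nonneg t x)]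
  have hrf : ∫⁻ x, r x ^ 2 ≠ ∞ := by
    simp only [hr2]; exact (integrable_rieszKernel ht).lintegral_lt_top.ne
  have k1 := isBoundedKernel_left_right hdm hdm hdf hdf
  have k2 := isBoundedKernel_right_output hdm hdm hdf hdf
  have k3 := k2.swap (by fun_prop)
  have k4 := isBoundedKernel_right_sub hdm hdm hdf hdf
  have k5 := k4.swap (by fun_prop)
  have k6 := isBoundedKernel_sub_sub hdm hdm hdf hdf
  have k7 := isBoundedKernel_sq_sub hrm hrf
  have k8 := k7.swap (by fun_prop)
  have k9 := isBoundedKernel_right_sub_right hdm hdm hdf hdf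
  have k10 := k9.swap (by fun_prop)
  have key := (((((((((k1.add (by fun_prop) k2).add (by fun_prop) k3).add (by fun_prop) k4).add
    (by fun_prop) k5).add (by fun_prop) k6).add (by fun_prop) k7).add (by fun_prop) k8).add
    (by fun_prop) k9).add (by fun_prop) k10)
  convert! key using 2 with v
  obtain ⟨x, y, z⟩ := v
  have d0 := decay_nonneg t
  have r0 := rieszKernel_nonneg t
  have dd (u v : ℝ) : 0 ≤ decay t u * decay t v := mul_nonneg (d0 u) (d0 v)
  simp only [hr2, hd, ← ENNReal.ofReal_mul (d0 _), majorant]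
  have e : z - y + x = x - y + z := by ring
  rw [e]
  iterate 9 rw [ENNReal.ofReal_add]
  all_goals first
    | exact dd _ _
    | exact r0 _
    | (repeat' apply add_nonneg) <;> first | exact dd _ _ | exact r0 _

/-! ### Fourier inversion almost everywhere -/

section FourierInversion

open scoped SchwartzMap ContDiff

lemma integral_fourier_mul_eq_of_integrable {f g : ℝ → ℂ} (hf : Integrable f)
    (hg : Integrable g) : ∫ ξ, 𝓕 f ξ * g ξ = ∫ x, f x * 𝓕 g x := by
  simpa using! VectorFourier.integral_bilin_fourierIntegral_eq_flip (.mul ℂ ℂ) (L := innerₗ ℝ)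
    Real.continuous_fourierChar continuous_inner hf hg

lemma continuous_fourier_of_integrable {f : ℝ → ℂ} (hf : Integrable f) : Continuous (𝓕 f) :=
  VectorFourier.fourierIntegral_continuous Real.continuous_fourierChar continuous_inner hf

lemma fourier_eq_zero_of_not_integrable {f : ℝ → ℂ} (hf : ¬ Integrable f) : 𝓕 f = 0 := by
  ext ξ
  rw [Real.fourier_eq, Pi.zero_apply, integral_undef]
  rwa [Real.fourierIntegral_convergent_iff]

lemma fourierInv_eq_zero_of_not_integrable {f : ℝ → ℂ} (hf : ¬ Integrable f) : 𝓕⁻ f = 0 := by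
  ext ξ
  rw [Real.fourierInv_eq_fourier_neg, fourier_eq_zero_of_not_integrable hf, Pi.zero_apply,
    Pi.zero_apply]

lemma measurable_fourier (f : ℝ → ℂ) : Measurable (𝓕 f) := by
  by_cases hf : Integrable f
  · exact (continuous_fourier_of_integrable hf).measurable
  · rw [fourier_eq_zero_of_not_integrable hf]
    exact measurable_zero

lemma integral_fourierInv_mul_fourier {f : ℝ → ℂ} (hf : Integrable f) (g : 𝓢(ℝ, ℂ)) :
    ∫ x, 𝓕⁻ f x * 𝓕 (g : ℝ → ℂ) x = ∫ x, f x * g x := by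
  have hinv : 𝓕 (𝓕⁻ (g : ℝ → ℂ)) = g := by
    rw [← SchwartzMap.fourierInv_coe, ← SchwartzMap.fourier_coe,
      FourierTransform.fourier_fourierInv_eq]
  have hint : Integrable (𝓕⁻ (g : ℝ → ℂ)) := by
    rw [← SchwartzMap.fourierInv_coe]
    exact (𝓕⁻ g).integrable
  rw [← hinv, ← integral_fourier_mul_eq_of_integrable hf hint, hinv, ← integral_neg_eq_self]
  simp only [Real.fourierInv_eq_fourier_neg, neg_neg]

/-- The Fourier inversion formula, almost everywhere, without continuity. -/
lemma fourier_fourierInv_ae_eq {f : ℝ → ℂ} (hf : Integrable f) (hf' : Integrable (𝓕⁻ f)) :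
    𝓕 (𝓕⁻ f) =ᵐ[volume] f := by
  refine ae_eq_of_integral_contDiff_smul_eq
    (continuous_fourier_of_integrable hf').locallyIntegrable hf.locallyIntegrable
    fun g hg hc => ?_
  have hc' : HasCompactSupport fun x => (g x : ℂ) := hc.comp_left (g := Complex.ofReal) rfl
  set G : 𝓢(ℝ, ℂ) := hc'.toSchwartzMap (Complex.ofRealCLM.contDiff.comp hg) with hG
  have hGg (x : ℝ) : G x = g x := rfl
  simp only [Complex.real_smul, ← hGg, mul_comm (G _)]
  rw [integral_fourier_mul_eq_of_integrable hf' G.integrable, integral_fourierInv_mul_fourier hf]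

end FourierInversion

/-! ### Sobolev norms and the trilinear operator -/

lemma sobolevNorm_nonneg (a : ℝ) (f : ℝ → ℂ) : 0 ≤ sobolevNorm a f :=
  Real.rpow_nonneg (integral_nonneg fun ξ =>
    mul_nonneg (Real.rpow_nonneg (jb_pos ξ).le _) (sq_nonneg _)) _

lemma sobolevNorm_sq (a : ℝ) (f : ℝ → ℂ) :
    sobolevNorm a f ^ 2 = ∫ ξ, jb ξ ^ (2 * a) * ‖𝓕 f ξ‖ ^ 2 := by
  rw [sobolevNorm, ← Real.sqrt_eq_rpow, Real.sq_sqrt]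
  exact integral_nonneg fun ξ => mul_nonneg (Real.rpow_nonneg (jb_pos ξ).le _) (sq_nonneg _)

lemma sobolevNorm_zero (a : ℝ) {f : ℝ → ℂ} (hf : 𝓕 f = 0) : sobolevNorm a f = 0 := by
  simp [sobolevNorm, hf]

lemma memHs.mono {a b : ℝ} (hab : a ≤ b) {f : ℝ → ℂ} (hf : memHs b f) : memHs a f := by
  refine Integrable.mono' hf (Measurable.aestronglyMeasurable ?_) (.of_forall fun ξ => ?_)
  · exact (continuous_jb.measurable.pow_const _).mul ((measurable_fourier f).norm.pow_const _)
  · have h := Real.rpow_nonneg (jb_pos ξ).le (2 * a)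
    rw [Real.norm_of_nonneg (by positivity)]
    gcongr
    exact one_le_jb ξ

lemma sq_ofReal_mul_enorm (a ξ : ℝ) (w : ℂ) :
    (ENNReal.ofReal (jb ξ ^ a) * ‖w‖ₑ) ^ 2 = ENNReal.ofReal (jb ξ ^ (2 * a) * ‖w‖ ^ 2) := by
  have h := Real.rpow_nonneg (jb_pos ξ).le a
  rw [← ofReal_norm, ← ENNReal.ofReal_mul h, ← ENNReal.ofReal_pow (by positivity),
    mul_pow, mul_comm 2 a, Real.rpow_mul (jb_pos ξ).le, Real.rpow_two]

lemma memHs.lintegral_eq {a : ℝ} {f : ℝ → ℂ} (hf : memHs a f) :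
    ∫⁻ ξ, (ENNReal.ofReal (jb ξ ^ a) * ‖𝓕 f ξ‖ₑ) ^ 2 = ENNReal.ofReal (sobolevNorm a f ^ 2) := by
  simp only [sq_ofReal_mul_enorm, sobolevNorm_sq]
  exact (ofReal_integral_eq_lintegral_ofReal hf <| .of_forall fun ξ =>
    mul_nonneg (Real.rpow_nonneg (jb_pos ξ).le _) (sq_nonneg _)).symm

lemma ofReal_sobolevNorm_sq_le (a : ℝ) (f : ℝ → ℂ) :
    ENNReal.ofReal (sobolevNorm a f ^ 2) ≤
      ∫⁻ ξ, (ENNReal.ofReal (jb ξ ^ a) * ‖𝓕 f ξ‖ₑ) ^ 2 := by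
  by_cases hf : memHs a f
  · exact hf.lintegral_eq.ge
  · rw [sobolevNorm_sq, integral_undef hf, ENNReal.ofReal_zero]
    exact zero_le

/-- The Fourier transform of `TwAbove M v₁ v₂ v₃`, as prescribed by its definition. -/
noncomputable def TwSymbol (M : ℝ) (v₁ v₂ v₃ : ℝ → ℂ) (ξ : ℝ) : ℂ :=
  ∫ ξ₁ : ℝ, ∫ ξ₂ : ℝ,
    (if M < |modPhi ξ ξ₁ ξ₂ (ξ - ξ₁ + ξ₂)| then
        ((|ξ₂| / jb (modPhi ξ ξ₁ ξ₂ (ξ - ξ₁ + ξ₂)) : ℝ) : ℂ)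
      else 0) *
      𝓕 v₁ ξ₁ * (starRingEnd ℂ) (𝓕 v₂ ξ₂) * 𝓕 v₃ (ξ - ξ₁ + ξ₂)

lemma ofReal_sobolevNorm_TwAbove_sq_le (a M : ℝ) (v₁ v₂ v₃ : ℝ → ℂ) :
    ENNReal.ofReal (sobolevNorm a (TwAbove M v₁ v₂ v₃) ^ 2) ≤
      ∫⁻ ξ, (ENNReal.ofReal (jb ξ ^ a) * ‖TwSymbol M v₁ v₂ v₃ ξ‖ₑ) ^ 2 := by
  have hT : TwAbove M v₁ v₂ v₃ = 𝓕⁻ (TwSymbol M v₁ v₂ v₃) := rfl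
  by_cases hT' : Integrable (TwAbove M v₁ v₂ v₃)
  · by_cases hF : Integrable (TwSymbol M v₁ v₂ v₃)
    · refine (ofReal_sobolevNorm_sq_le _ _).trans_eq (lintegral_congr_ae ?_)
      filter_upwards [fourier_fourierInv_ae_eq hF hT'] with ξ hξ
      rw [hT, hξ]
    · have h0 : 𝓕 (TwAbove M v₁ v₂ v₃) = 0 := by
        rw [hT, fourierInv_eq_zero_of_not_integrable hF]
        ext ξ
        simp [Real.fourier_eq]
      simp [sobolevNorm_zero a h0]
  · simp [sobolevNorm_zero a (fourier_eq_zero_of_not_integrable hT')]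

lemma weighted_TwSymbol_le {s t M : ℝ} (hs : 1 / 2 < s) (ht : t = 1 - min s (3 / 4))
    (hM : 1 ≤ M) (j : Fin 3) {e : Fin 3 → ℝ} (he : ∀ i, e i = if i = j then s - 1 else s)
    (v : Fin 3 → ℝ → ℂ) (ξ : ℝ) :
    ENNReal.ofReal (jb ξ ^ (s - 1)) * ‖TwSymbol M (v 0) (v 1) (v 2) ξ‖ₑ ≤
      ENNReal.ofReal (Real.exp (9 * Real.log 4 + s * Real.log 3) *
        M ^ (-(min (2 * s - 1) (1 / 2)))) *
      ∫⁻ x, ∫⁻ y, ENNReal.ofReal (majorant t x y (ξ - x + y)) *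
        ((ENNReal.ofReal (jb x ^ e 0) * ‖𝓕 (v 0) x‖ₑ) *
          (ENNReal.ofReal (jb y ^ e 1) * ‖𝓕 (v 1) y‖ₑ) *
          (ENNReal.ofReal (jb (ξ - x + y) ^ e 2) * ‖𝓕 (v 2) (ξ - x + y)‖ₑ)) := by
  have hj (a x : ℝ) : 0 ≤ jb x ^ a := Real.rpow_nonneg (jb_pos x).le a
  obtain ⟨c, hc⟩ : ∃ c, Real.exp (9 * Real.log 4 + s * Real.log 3) *
      M ^ (-(min (2 * s - 1) (1 / 2))) = c := ⟨_, rfl⟩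
  have hc0 : 0 ≤ c := hc ▸ mul_nonneg (Real.exp_nonneg _) (Real.rpow_nonneg (by linarith) _)
  rw [hc]
  rw [← lintegral_const_mul' _ _ ENNReal.ofReal_ne_top]
  refine (mul_le_mul_right (enorm_integral_le_lintegral_enorm _) _).trans ?_
  rw [← lintegral_const_mul' _ _ ENNReal.ofReal_ne_top]
  refine lintegral_mono fun x => ?_
  rw [← lintegral_const_mul' _ _ ENNReal.ofReal_ne_top]
  refine (mul_le_mul_right (enorm_integral_le_lintegral_enorm _) _).trans ?_
  rw [← lintegral_const_mul' _ _ ENNReal.ofReal_ne_top]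
  refine lintegral_mono fun y => ?_
  simp only
  split_ifs with h
  · have hξ : x - y + (ξ - x + y) = ξ := by ring
    have key := multiplier_le hs ht hM j he (x := x) (y := y) (z := ξ - x + y) (by rwa [hξ])
    rw [hξ, hc] at key
    have key' := ENNReal.ofReal_le_ofReal key
    have hw : 0 ≤ jb x ^ e 0 * jb y ^ e 1 * jb (ξ - x + y) ^ e 2 :=
      mul_nonneg (mul_nonneg (hj _ _) (hj _ _)) (hj _ _)
    have hm : 0 ≤ |y| / jb (modPhi ξ x y (ξ - x + y)) := div_nonneg (abs_nonneg _) (jb_pos _).le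
    rw [ENNReal.ofReal_mul (hj _ _), ENNReal.ofReal_mul (mul_nonneg hc0 hw),
      ENNReal.ofReal_mul hc0, ENNReal.ofReal_mul (mul_nonneg (hj _ _) (hj _ _)), ENNReal.ofReal_mul (hj _ _)]
      at key'
    have henorm : ‖((|y| / jb (modPhi ξ x y (ξ - x + y)) : ℝ) : ℂ)‖ₑ =
        ENNReal.ofReal (|y| / jb (modPhi ξ x y (ξ - x + y))) := by
      rw [← ofReal_norm, Complex.norm_real, Real.norm_of_nonneg hm]
    simp only [enorm_mul, RCLike.enorm_conj, henorm]
    calc _ = ENNReal.ofReal (jb ξ ^ (s - 1)) *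
          ENNReal.ofReal (|y| / jb (modPhi ξ x y (ξ - x + y))) *
          (‖𝓕 (v 0) x‖ₑ * ‖𝓕 (v 1) y‖ₑ * ‖𝓕 (v 2) (ξ - x + y)‖ₑ) := by ring
      _ ≤ _ := mul_le_mul_left key' _
      _ = _ := by ring
  · simp

/-- The weak-norm estimate for `T^w_{|Φ|>M}`: for `s > 1/2`,
`θ = min(2s-1, 1/2)`, any `M ≥ 1` and any assignment (permutation `σ`) of the
three inputs, `‖T^w_{|Φ|>M}(v₁,v₂,v₃)‖_{H^{s-1}} ≤ C M^{-θ}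
‖v_j‖_{H^{s-1}} ‖v_k‖_{H^s} ‖v_l‖_{H^s}`. -/
theorem Tw_weak_estimate (s : ℝ) (hs : 1 / 2 < s) :
    ∃ C : ℝ, 0 < C ∧ ∀ M : ℝ, 1 ≤ M → ∀ v : Fin 3 → (ℝ → ℂ),
      (∀ i, memHs s (v i)) → ∀ σ : Equiv.Perm (Fin 3),
      sobolevNorm (s - 1) (TwAbove M (v 0) (v 1) (v 2)) ≤
        C * M ^ (-(min (2 * s - 1) (1 / 2))) *
          (sobolevNorm (s - 1) (v (σ 0)) *
            sobolevNorm s (v (σ 1)) * sobolevNorm s (v (σ 2))) := by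
  obtain ⟨D, hD, hK⟩ := isBoundedKernel_majorant (t := 1 - min s (3 / 4))
    (by have := lt_min hs (by norm_num : (1 / 2 : ℝ) < 3 / 4); linarith)
  set A : ℝ := Real.exp (9 * Real.log 4 + s * Real.log 3) with hA
  have hA0 : 0 < A := Real.exp_pos _
  refine ⟨A * (√D.toReal + 1), by positivity, fun M hM v hv σ => ?_⟩
  set e : Fin 3 → ℝ := fun i => if i = σ 0 then s - 1 else s with he
  have hve (i : Fin 3) : memHs (e i) (v i) := (hv i).mono (by simp only [he]; split_ifs <;> linarith)
  set n : Fin 3 → ℝ := fun i => sobolevNorm (e i) (v i) with hn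
  have hn0 (i : Fin 3) : 0 ≤ n i := sobolevNorm_nonneg _ _
  have hperm : sobolevNorm (s - 1) (v (σ 0)) * sobolevNorm s (v (σ 1)) * sobolevNorm s (v (σ 2)) =
      n 0 * n 1 * n 2 := by
    rw [← Fin.prod_univ_three, ← Equiv.prod_comp σ, Fin.prod_univ_three]
    simp [hn, he]
  set c : ℝ := A * M ^ (-(min (2 * s - 1) (1 / 2))) with hc
  have hc0 : 0 ≤ c := mul_nonneg hA0.le (Real.rpow_nonneg (by linarith) _)
  have hmeas (i : Fin 3) : Measurable fun x => ENNReal.ofReal (jb x ^ e i) * ‖𝓕 (v i) x‖ₑ :=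
    (continuous_jb.measurable.pow_const _).ennreal_ofReal.mul (measurable_fourier _).enorm
  have hsq : sobolevNorm (s - 1) (TwAbove M (v 0) (v 1) (v 2)) ^ 2 ≤
      (c * √D.toReal * (n 0 * n 1 * n 2)) ^ 2 := by
    rw [← ENNReal.ofReal_le_ofReal_iff (sq_nonneg _)]
    calc _ ≤ _ := ofReal_sobolevNorm_TwAbove_sq_le _ _ _ _ _
      _ ≤ _ := lintegral_mono fun ξ =>
        pow_le_pow_left' (weighted_TwSymbol_le hs rfl hM (σ 0) (fun _ => rfl) v ξ) 2
      _ ≤ ENNReal.ofReal c ^ 2 * (D * (ENNReal.ofReal (n 0 ^ 2) * ENNReal.ofReal (n 1 ^ 2) *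
          ENNReal.ofReal (n 2 ^ 2))) := by
        simp only [mul_pow (ENNReal.ofReal _) (lintegral _ _)]
        rw [lintegral_const_mul' _ _ (ENNReal.pow_ne_top ENNReal.ofReal_ne_top)]
        simp only [hn, ← (hve _).lintegral_eq]
        exact mul_le_mul_right (hK _ _ _ (hmeas 0) (hmeas 1) (hmeas 2)) _
      _ = _ := by
        clear_value c n
        simp only [mul_pow, Real.sq_sqrt ENNReal.toReal_nonneg]
        rw [ENNReal.ofReal_mul (by positivity), ENNReal.ofReal_mul (by positivity),
          ENNReal.ofReal_mul (by positivity), ENNReal.ofReal_mul (by positivity),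
          ENNReal.ofReal_toReal hD, ENNReal.ofReal_pow hc0]
        ring
  rw [hperm]
  have hprod : 0 ≤ n 0 * n 1 * n 2 := mul_nonneg (mul_nonneg (hn0 0) (hn0 1)) (hn0 2)
  calc _ ≤ c * √D.toReal * (n 0 * n 1 * n 2) :=
        le_of_sq_le_sq hsq (mul_nonneg (mul_nonneg hc0 (Real.sqrt_nonneg _)) hprod)
    _ ≤ c * (√D.toReal + 1) * (n 0 * n 1 * n 2) := by gcongr; linarith
    _ = _ := by rw [hc]; ring
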